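/- Let R be an algebraic curvature tensor on E with nonnegative isotropic curvature, and suppose the orthonormal four-frame {e_1,e_2,e_3,e_4} attains isotropic curvature zero. Then Q(R)_{1313} + Q(R)_{1414} + Q(R)_{2323} + Q(R)_{2424} - 2 Q(R)_{1234} ≥ 0. -/

import Mathlib

open scoped BigOperators
open RealInnerProductSpace

noncomputable section

abbrev Euc (n : ℕ) : Type := EuclideanSpace ℝ (Fin n)

/-- The space of quadrilinear (multilinear) maps `E → E → E → E → ℝ`. -/
abbrev CurvMap (n : ℕ) : Type := Euc n →ₗ[ℝ] Euc n →ₗ[ℝ] Euc n →ₗ[ℝ] Euc n →ₗ[ℝ] ℝ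

/-- `R` is an algebraic curvature tensor: antisymmetric in the first two arguments,
symmetric under interchange of the first and second pair, and satisfying the
first Bianchi identity. -/
def IsCurvatureTensor {n : ℕ} (R : CurvMap n) : Prop :=
  (∀ x y z w : Euc n, R x y z w = - R y x z w) ∧
  (∀ x y z w : Euc n, R x y z w = R z w x y) ∧
  (∀ x y z w : Euc n, R x y z w + R y z x w + R z x y w = 0)

/-- Nonnegative isotropic curvature for a quadrilinear form on `EuclideanSpace ℝ (Fin m)`. -/
def NonnegIsotropic {m : ℕ} (R : Euc m → Euc m → Euc m → Euc m → ℝ) : Prop :=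
  ∀ v₁ v₂ v₃ v₄ : Euc m, Orthonormal ℝ ![v₁, v₂, v₃, v₄] →
    0 ≤ R v₁ v₃ v₁ v₃ + R v₁ v₄ v₁ v₄ + R v₂ v₃ v₂ v₃ + R v₂ v₄ v₂ v₄ - 2 * R v₁ v₂ v₃ v₄

/-- The Hamilton quadratic term `Q(R)_{ijkl}` in the orthonormal basis `b`. -/
def Qc {n : ℕ} (R : CurvMap n) (b : OrthonormalBasis (Fin n) ℝ (Euc n))
    (i j k l : Fin n) : ℝ :=
  ∑ p : Fin n, ∑ q : Fin n,
    (R (b i) (b j) (b p) (b q) * R (b k) (b l) (b p) (b q)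
      + 2 * R (b i) (b p) (b k) (b q) * R (b j) (b p) (b l) (b q)
      - 2 * R (b i) (b p) (b l) (b q) * R (b j) (b p) (b k) (b q))

open Matrix

/-- Complex coordinate vectors. -/
abbrev CVec (n : ℕ) : Type := Fin n → ℂ

/-- The space of complex quadrilinear forms on `ℂⁿ`. -/
abbrev CForm (n : ℕ) : Type :=
  CVec n →ₗ[ℂ] CVec n →ₗ[ℂ] CVec n →ₗ[ℂ] CVec n →ₗ[ℂ] ℂ

/-- `T` has the symmetries of the complex multilinear extension of a real curvature tensor. -/
structure IsComplexCurvature {n : ℕ} (T : CForm n) : Prop where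
  antisymm : ∀ x y z w, T x y z w = -T y x z w
  pair : ∀ x y z w, T x y z w = T z w x y
  bianchi : ∀ x y z w, T x y z w + T y z x w + T z x y w = 0
  conj : ∀ x y z w, star (T x y z w) = T (star x) (star y) (star z) (star w)

/-- Nonnegativity of the complex sectional curvature on isotropic planes. -/
def NonnegOnIsotropic {n : ℕ} (T : CForm n) : Prop :=
  ∀ x y : CVec n, x ⬝ᵥ x = 0 → y ⬝ᵥ y = 0 → x ⬝ᵥ y = 0 → 0 ≤ (T x y (star x) (star y)).re

/-- `ζ` and `η` span an isotropic plane and are Hermitian-orthogonal of norm `√2`. -/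
structure IsNullFrame {n : ℕ} (ζ η : CVec n) : Prop where
  zz : ζ ⬝ᵥ ζ = 0
  ee : η ⬝ᵥ η = 0
  ze : ζ ⬝ᵥ η = 0
  zz' : ζ ⬝ᵥ star ζ = 2
  ee' : η ⬝ᵥ star η = 2
  ze' : ζ ⬝ᵥ star η = 0

section FirstAndSecondVariation

lemma first_second_order_of_nonneg (c₁ c₂ : ℂ) (ρ : ℝ → ℂ) (hρ : Continuous ρ)
    (h : ∀ s : ℝ, 0 ≤ ((s : ℂ) * c₁ + (s : ℂ) ^ 2 * c₂ + (s : ℂ) ^ 3 * ρ s).re) :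
    c₁.re = 0 ∧ 0 ≤ c₂.re := by
  have limit_nonneg : ∀ g : ℝ → ℝ, Continuous g → (∀ s : ℝ, 0 < s → 0 ≤ g s) → 0 ≤ g 0 := by
    intro g hg hpos
    refine ge_of_tendsto (hg.continuousWithinAt (s := Set.Ioi 0) (x := 0)) ?_
    filter_upwards [self_mem_nhdsWithin] with s hs using hpos s hs
  have expand : ∀ s : ℝ, ((s : ℂ) * c₁ + (s : ℂ) ^ 2 * c₂ + (s : ℂ) ^ 3 * ρ s).re
      = s * (c₁.re + s * c₂.re + s ^ 2 * (ρ s).re) := by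
    intro s
    simp only [← Complex.ofReal_pow, Complex.add_re, Complex.re_ofReal_mul]
    ring
  have hre : Continuous fun s => (ρ s).re := Complex.continuous_re.comp hρ
  have hre' : Continuous fun s => (ρ (-s)).re := hre.comp continuous_neg
  have h₁ : 0 ≤ c₁.re := by
    have := limit_nonneg (fun s => c₁.re + s * c₂.re + s ^ 2 * (ρ s).re) (by fun_prop) (by
      intro s hs
      have := h s
      rw [expand] at this
      exact nonneg_of_mul_nonneg_right this hs)
    simpa using this
  have h₂ : 0 ≤ -c₁.re := by
    have := limit_nonneg (fun s => -(c₁.re + (-s) * c₂.re + s ^ 2 * (ρ (-s)).re)) (by fun_prop) (by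
      intro s hs
      have := h (-s)
      rw [expand] at this
      refine nonneg_of_mul_nonneg_right (a := s) ?_ hs
      linarith)
    simpa using this
  have hc : c₁.re = 0 := by linarith
  refine ⟨hc, ?_⟩
  have := limit_nonneg (fun s => c₂.re + s * (ρ s).re) (by fun_prop) (by
    intro s hs
    have := h s
    rw [expand, hc] at this
    refine nonneg_of_mul_nonneg_right (a := s ^ 2) ?_ (by positivity)
    linarith)
  simpa using this

lemma sesquilinear_polynomial_nonneg (h : Fin 5 → Fin 5 → ℂ) (h₀ : h 0 0 = 0)
    (hconj : h 0 1 = star (h 1 0))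
    (hpos : ∀ t : ℂ, 0 ≤ (∑ j : Fin 5, ∑ k : Fin 5, t ^ (j : ℕ) * star t ^ (k : ℕ) * h j k).re) :
    h 1 0 = 0 ∧ 0 ≤ (h 1 1).re := by
  have along : ∀ ω : ℂ, (ω * h 1 0 + star ω * h 0 1).re = 0 ∧
      0 ≤ (ω * star ω * h 1 1 + ω ^ 2 * h 2 0 + star ω ^ 2 * h 0 2).re := by
    intro ω
    refine first_second_order_of_nonneg _ _ (fun s =>
      (ω ^ 3 * h 3 0 + ω ^ 2 * star ω * h 2 1 + ω * star ω ^ 2 * h 1 2 + star ω ^ 3 * h 0 3)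
      + (s : ℂ) * (ω ^ 4 * h 4 0 + ω ^ 3 * star ω * h 3 1 + ω ^ 2 * star ω ^ 2 * h 2 2
        + ω * star ω ^ 3 * h 1 3 + star ω ^ 4 * h 0 4)
      + (s : ℂ) ^ 2 * (ω ^ 4 * star ω * h 4 1 + ω ^ 3 * star ω ^ 2 * h 3 2
        + ω ^ 2 * star ω ^ 3 * h 2 3 + ω * star ω ^ 4 * h 1 4)
      + (s : ℂ) ^ 3 * (ω ^ 4 * star ω ^ 2 * h 4 2 + ω ^ 3 * star ω ^ 3 * h 3 3
        + ω ^ 2 * star ω ^ 4 * h 2 4)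
      + (s : ℂ) ^ 4 * (ω ^ 4 * star ω ^ 3 * h 4 3 + ω ^ 3 * star ω ^ 4 * h 3 4)
      + (s : ℂ) ^ 5 * (ω ^ 4 * star ω ^ 4 * h 4 4)) (by fun_prop) ?_
    intro s
    convert hpos (s * ω) using 2
    have hs : star (s : ℂ) = s := Complex.conj_ofReal s
    simp only [Fin.sum_univ_five, star_mul', hs, h₀, Fin.val_zero, Fin.val_one, Fin.val_two,
      show ((3 : Fin 5) : ℕ) = 3 from rfl, show ((4 : Fin 5) : ℕ) = 4 from rfl]
    ring
  obtain ⟨h1, h1'⟩ := along 1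
  obtain ⟨hI, hI'⟩ := along Complex.I
  have hIstar : star Complex.I = -Complex.I := Complex.conj_I
  simp only [hconj, hIstar, star_one, one_mul, one_pow, Complex.add_re, Complex.mul_re,
    Complex.neg_re, Complex.I_re, Complex.I_im, neg_sq, Complex.I_sq, mul_neg,
    Complex.I_mul_I, neg_neg, neg_mul, Complex.star_def, Complex.conj_re, Complex.conj_im]
    at h1 h1' hI hI'
  refine ⟨Complex.ext ?_ ?_, ?_⟩
  · simp only [Complex.zero_re]; linarith
  · simp only [Complex.zero_im]; linarith
  · linarith

variable {n : ℕ} {T : CForm n}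

lemma variation_of_nonneg (hT : IsComplexCurvature T) (z₀ z₁ z₂ e₀ e₁ e₂ : CVec n)
    (h₀ : T z₀ e₀ (star z₀) (star e₀) = 0)
    (hpos : ∀ t : ℂ, 0 ≤ (T (z₀ + t • z₁ + t ^ 2 • z₂) (e₀ + t • e₁ + t ^ 2 • e₂)
      (star (z₀ + t • z₁ + t ^ 2 • z₂)) (star (e₀ + t • e₁ + t ^ 2 • e₂))).re) :
    T z₁ e₀ (star z₀) (star e₀) + T z₀ e₁ (star z₀) (star e₀) = 0 ∧
    0 ≤ (T z₁ e₀ (star z₁) (star e₀) + T z₁ e₀ (star z₀) (star e₁)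
      + T z₀ e₁ (star z₁) (star e₀) + T z₀ e₁ (star z₀) (star e₁)).re := by
  let m : Fin 5 → CVec n →ₗ[ℂ] CVec n →ₗ[ℂ] ℂ :=
    ![T z₀ e₀, T z₁ e₀ + T z₀ e₁, T z₂ e₀ + T z₁ e₁ + T z₀ e₂, T z₂ e₁ + T z₁ e₂, T z₂ e₂]
  let k : (CVec n →ₗ[ℂ] CVec n →ₗ[ℂ] ℂ) → Fin 5 → ℂ := fun B =>
    ![B (star z₀) (star e₀), B (star z₁) (star e₀) + B (star z₀) (star e₁),
      B (star z₂) (star e₀) + B (star z₁) (star e₁) + B (star z₀) (star e₂),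
      B (star z₂) (star e₁) + B (star z₁) (star e₂), B (star z₂) (star e₂)]
  have hm : ∀ t : ℂ, T (z₀ + t • z₁ + t ^ 2 • z₂) (e₀ + t • e₁ + t ^ 2 • e₂)
      = ∑ j : Fin 5, t ^ (j : ℕ) • m j := by
    intro t
    simp only [m, Fin.sum_univ_five, map_add, map_smul, LinearMap.add_apply, LinearMap.smul_apply]
    simp
    module
  have hk : ∀ B t, B (star (z₀ + t • z₁ + t ^ 2 • z₂)) (star (e₀ + t • e₁ + t ^ 2 • e₂))
      = ∑ j : Fin 5, star t ^ (j : ℕ) * k B j := by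
    intro B t
    simp only [k, Fin.sum_univ_five, star_add, star_smul, star_pow, map_add, map_smul,
      LinearMap.add_apply, LinearMap.smul_apply, smul_eq_mul]
    simp
    ring
  have key := sesquilinear_polynomial_nonneg (fun i j => k (m i) j) h₀
    (by
      simp only [k, m, Matrix.cons_val_zero, Matrix.cons_val_one, LinearMap.add_apply, star_add,
        hT.conj, star_star]
      rw [hT.pair z₀ e₀, hT.pair z₀ e₀])
    (by
      intro t
      convert hpos t using 2
      rw [hm]
      simp only [LinearMap.sum_apply, LinearMap.smul_apply, hk, smul_eq_mul, Finset.mul_sum]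
      simp only [mul_assoc])
  simp only [k, m, Matrix.cons_val_zero, Matrix.cons_val_one, LinearMap.add_apply] at key
  refine ⟨key.1, ?_⟩
  convert key.2 using 2
  ring

end FirstAndSecondVariation

section NullFrame

variable {n : ℕ} {T : CForm n} {ζ η : CVec n}

lemma star_dotProduct_eq_zero_iff (x y : CVec n) : star x ⬝ᵥ y = 0 ↔ x ⬝ᵥ star y = 0 := by
  rw [← star_eq_zero, Matrix.star_dotProduct, star_star, dotProduct_comm]

/-- `p` is orthogonal to `ζ`, `η` and their conjugates for the bilinear dot product. -/
structure IsOrthToFrame (ζ η p : CVec n) : Prop where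
  z : p ⬝ᵥ ζ = 0
  z' : p ⬝ᵥ star ζ = 0
  e : p ⬝ᵥ η = 0
  e' : p ⬝ᵥ star η = 0

lemma IsOrthToFrame.zero : IsOrthToFrame ζ η 0 := by
  constructor <;> simp

lemma IsOrthToFrame.star {p : CVec n} (hp : IsOrthToFrame ζ η p) :
    IsOrthToFrame ζ η (star p) where
  z := by rw [star_dotProduct_eq_zero_iff, hp.z']
  z' := by rw [star_dotProduct_eq_zero_iff, star_star, hp.z]
  e := by rw [star_dotProduct_eq_zero_iff, hp.e']
  e' := by rw [star_dotProduct_eq_zero_iff, star_star, hp.e]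

namespace IsNullFrame

lemma ze'' (hf : IsNullFrame ζ η) : star ζ ⬝ᵥ η = 0 := by
  rw [star_dotProduct_eq_zero_iff, hf.ze']

lemma zz'' (hf : IsNullFrame ζ η) : star ζ ⬝ᵥ star ζ = 0 := by
  rw [star_dotProduct_eq_zero_iff, star_star, hf.zz]

lemma ee'' (hf : IsNullFrame ζ η) : star η ⬝ᵥ star η = 0 := by
  rw [star_dotProduct_eq_zero_iff, star_star, hf.ee]

lemma ss (hf : IsNullFrame ζ η) : star ζ ⬝ᵥ star η = 0 := by
  rw [star_dotProduct_eq_zero_iff, star_star, hf.ze]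

/-- First and second variation of the isotropic curvature in directions orthogonal to the frame;
the quadratic corrections keep the deformed plane isotropic. -/
lemma variation_orth (hT : IsComplexCurvature T) (hpos : NonnegOnIsotropic T)
    (hf : IsNullFrame ζ η) (h₀ : T ζ η (star ζ) (star η) = 0) {p q : CVec n}
    (hp : IsOrthToFrame ζ η p) (hq : IsOrthToFrame ζ η q) :
    T p η (star ζ) (star η) + T ζ q (star ζ) (star η) = 0 ∧
    0 ≤ (T p η (star p) (star η) + T p η (star ζ) (star q)
      + T ζ q (star p) (star η) + T ζ q (star ζ) (star q)).re := by
  have := hf.zz; have := hf.ee; have := hf.ze; have := hf.zz'; have := hf.ee'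
  have := hf.ze'; have := hf.ze''; have := hf.zz''; have := hf.ee''; have := hf.ss
  have := hp.z; have := hp.z'; have := hp.e; have := hp.e'
  have := hq.z; have := hq.z'; have := hq.e; have := hq.e'
  have hz2 := dotProduct_comm (star ζ) ζ
  have he2 := dotProduct_comm (star η) η
  have hez := dotProduct_comm η ζ
  have hez' := dotProduct_comm η (star ζ)
  have hez'' := dotProduct_comm (star η) ζ
  have hss := dotProduct_comm (star η) (star ζ)
  have hzp := dotProduct_comm ζ p
  have hzp' := dotProduct_comm (star ζ) p
  have hep := dotProduct_comm η p
  have hep' := dotProduct_comm (star η) p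
  have hzq := dotProduct_comm ζ q
  have hzq' := dotProduct_comm (star ζ) q
  have heq := dotProduct_comm η q
  have heq' := dotProduct_comm (star η) q
  refine variation_of_nonneg hT ζ p (-(p ⬝ᵥ p / 4) • star ζ - (p ⬝ᵥ q / 2) • star η)
    η q (-(q ⬝ᵥ q / 4) • star η) h₀ fun t => hpos _ _ ?_ ?_ ?_
  all_goals
    simp only [dotProduct_add, add_dotProduct, dotProduct_sub, sub_dotProduct, dotProduct_smul,
      smul_dotProduct, smul_eq_mul, *]
    ring

lemma variation_rotation (hT : IsComplexCurvature T) (hpos : NonnegOnIsotropic T)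
    (hf : IsNullFrame ζ η) (h₀ : T ζ η (star ζ) (star η) = 0) :
    T (star η) η (star ζ) (star η) = T ζ (star ζ) (star ζ) (star η) := by
  have := hf.zz; have := hf.ee; have := hf.ze; have := hf.zz'; have := hf.ee'
  have := hf.ze'; have := hf.ze''; have := hf.zz''; have := hf.ee''; have := hf.ss
  have hz2 := dotProduct_comm (star ζ) ζ
  have he2 := dotProduct_comm (star η) η
  have hez := dotProduct_comm η ζ
  have hez' := dotProduct_comm η (star ζ)
  have hez'' := dotProduct_comm (star η) ζ
  have hss := dotProduct_comm (star η) (star ζ)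
  have key : T (star η) η (star ζ) (star η) + T ζ (-star ζ) (star ζ) (star η) = 0 := by
    refine (variation_of_nonneg hT ζ (star η) 0 η (-star ζ) 0 h₀ fun t => hpos _ _ ?_ ?_ ?_).1
    all_goals
      simp only [dotProduct_add, add_dotProduct, dotProduct_neg, neg_dotProduct, dotProduct_smul,
        smul_dotProduct, smul_eq_mul, smul_zero, dotProduct_zero, zero_dotProduct, *]
      ring
  simp only [map_neg, LinearMap.neg_apply] at key
  linear_combination key

end IsNullFrame

/-- Projection onto the common orthogonal complement of `ζ`, `η` and their conjugates. -/
def frameProj (ζ η : CVec n) : CVec n →ₗ[ℂ] CVec n where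
  toFun x := x - (1 / 2 : ℂ) • ((x ⬝ᵥ star ζ) • ζ + (x ⬝ᵥ ζ) • star ζ
    + (x ⬝ᵥ star η) • η + (x ⬝ᵥ η) • star η)
  map_add' x y := by simp only [add_dotProduct]; module
  map_smul' c x := by simp only [smul_dotProduct, smul_eq_mul, RingHom.id_apply]; module

lemma frameProj_apply (x : CVec n) : frameProj ζ η x =
    x - (1 / 2 : ℂ) • ((x ⬝ᵥ star ζ) • ζ + (x ⬝ᵥ ζ) • star ζ
      + (x ⬝ᵥ star η) • η + (x ⬝ᵥ η) • star η) := rfl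

lemma star_frameProj (x : CVec n) : star (frameProj ζ η x) = frameProj ζ η (star x) := by
  have h : ∀ y : CVec n, star (x ⬝ᵥ y) = star x ⬝ᵥ star y := fun y => by
    rw [Matrix.star_dotProduct_star, dotProduct_comm]
  simp only [frameProj_apply, star_sub, star_smul, star_add, h, star_star, star_div₀, star_one,
    star_ofNat]
  module

lemma isOrthToFrame_frameProj (hf : IsNullFrame ζ η) (x : CVec n) :
    IsOrthToFrame ζ η (frameProj ζ η x) := by
  have := hf.zz; have := hf.ee; have := hf.ze; have := hf.zz'; have := hf.ee'
  have := hf.ze'; have := hf.ze''; have := hf.zz''; have := hf.ee''; have := hf.ss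
  have hz2 := dotProduct_comm (star ζ) ζ
  have he2 := dotProduct_comm (star η) η
  have hez := dotProduct_comm η ζ
  have hez' := dotProduct_comm η (star ζ)
  have hez'' := dotProduct_comm (star η) ζ
  have hss := dotProduct_comm (star η) (star ζ)
  constructor <;>
  · simp only [frameProj_apply, sub_dotProduct, add_dotProduct, smul_dotProduct, smul_eq_mul, *]
    ring

lemma linear_eq_sum (f : CVec n →ₗ[ℂ] ℂ) (x : CVec n) :
    f x = ∑ p, f (Pi.single p 1) * x p := by
  conv_lhs => rw [pi_eq_sum_univ' x]
  simp [mul_comm]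

/-- The Euclidean contraction of two linear forms in a basis adapted to the null frame. -/
lemma contraction_frame (hf : IsNullFrame ζ η) (f g : CVec n →ₗ[ℂ] ℂ) :
    ∑ p, f (Pi.single p 1) * g (Pi.single p 1) =
      1 / 2 * (f ζ * g (star ζ) + f (star ζ) * g ζ + f η * g (star η) + f (star η) * g η)
      + ∑ p, f (frameProj ζ η (Pi.single p 1)) * g (frameProj ζ η (Pi.single p 1)) := by
  have hfs := linear_eq_sum f
  have hgs := linear_eq_sum g
  have hzz : ∑ p, ζ p * ζ p = 0 := hf.zz
  have hee : ∑ p, η p * η p = 0 := hf.ee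
  have hze : ∑ p, ζ p * η p = 0 := hf.ze
  have hzz' : ∑ p, ζ p * star ζ p = 2 := hf.zz'
  have hee' : ∑ p, η p * star η p = 2 := hf.ee'
  have hze' : ∑ p, ζ p * star η p = 0 := hf.ze'
  have hze'' : ∑ p, star ζ p * η p = 0 := hf.ze''
  have hzzs : ∑ p, star ζ p * star ζ p = 0 := hf.zz''
  have hees : ∑ p, star η p * star η p = 0 := hf.ee''
  have hss : ∑ p, star ζ p * star η p = 0 := hf.ss
  have expand : ∀ p, f (frameProj ζ η (Pi.single p 1)) * g (frameProj ζ η (Pi.single p 1)) =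
      f (Pi.single p 1) * g (Pi.single p 1)
      - 1 / 2 * (g ζ * (f (Pi.single p 1) * star ζ p) + g (star ζ) * (f (Pi.single p 1) * ζ p)
        + g η * (f (Pi.single p 1) * star η p) + g (star η) * (f (Pi.single p 1) * η p))
      - 1 / 2 * (f ζ * (g (Pi.single p 1) * star ζ p) + f (star ζ) * (g (Pi.single p 1) * ζ p)
        + f η * (g (Pi.single p 1) * star η p) + f (star η) * (g (Pi.single p 1) * η p))
      + 1 / 4 * (f ζ * g ζ * (star ζ p * star ζ p) + f (star ζ) * g (star ζ) * (ζ p * ζ p)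
        + f η * g η * (star η p * star η p) + f (star η) * g (star η) * (η p * η p)
        + (f ζ * g (star ζ) + f (star ζ) * g ζ) * (ζ p * star ζ p)
        + (f η * g (star η) + f (star η) * g η) * (η p * star η p)
        + (f ζ * g η + f η * g ζ) * (star ζ p * star η p)
        + (f (star ζ) * g (star η) + f (star η) * g (star ζ)) * (ζ p * η p)
        + (f (star ζ) * g η + f η * g (star ζ)) * (ζ p * star η p)
        + (f ζ * g (star η) + f (star η) * g ζ) * (star ζ p * η p)) := by
    intro p
    simp only [frameProj_apply, single_dotProduct, one_mul, map_sub, map_smul, map_add, smul_eq_mul]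
    ring
  simp only [expand, Finset.sum_add_distrib, Finset.sum_sub_distrib, ← Finset.mul_sum,
    hzz, hee, hze, hzz', hee', hze', hze'', hzzs, hees, hss, ← hfs, ← hgs]
  ring

/-- The double contraction of two bilinear forms in a basis adapted to the null frame. -/
lemma double_contraction_frame (hf : IsNullFrame ζ η) (A B : CVec n →ₗ[ℂ] CVec n →ₗ[ℂ] ℂ) :
    ∑ p, ∑ q, A (Pi.single p 1) (Pi.single q 1) * B (Pi.single p 1) (Pi.single q 1) =
      1 / 4 * (A ζ ζ * B (star ζ) (star ζ) + A (star ζ) ζ * B ζ (star ζ)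
          + A η ζ * B (star η) (star ζ) + A (star η) ζ * B η (star ζ)
        + A ζ (star ζ) * B (star ζ) ζ + A (star ζ) (star ζ) * B ζ ζ
          + A η (star ζ) * B (star η) ζ + A (star η) (star ζ) * B η ζ
        + A ζ η * B (star ζ) (star η) + A (star ζ) η * B ζ (star η)
          + A η η * B (star η) (star η) + A (star η) η * B η (star η)
        + A ζ (star η) * B (star ζ) η + A (star ζ) (star η) * B ζ η
          + A η (star η) * B (star η) η + A (star η) (star η) * B η η)
      + 1 / 2 * ∑ p, (A (frameProj ζ η (Pi.single p 1)) ζ * B (frameProj ζ η (Pi.single p 1)) (star ζ)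
        + A (frameProj ζ η (Pi.single p 1)) (star ζ) * B (frameProj ζ η (Pi.single p 1)) ζ
        + A (frameProj ζ η (Pi.single p 1)) η * B (frameProj ζ η (Pi.single p 1)) (star η)
        + A (frameProj ζ η (Pi.single p 1)) (star η) * B (frameProj ζ η (Pi.single p 1)) η)
      + 1 / 2 * ∑ q, (A ζ (frameProj ζ η (Pi.single q 1)) * B (star ζ) (frameProj ζ η (Pi.single q 1))
        + A (star ζ) (frameProj ζ η (Pi.single q 1)) * B ζ (frameProj ζ η (Pi.single q 1))
        + A η (frameProj ζ η (Pi.single q 1)) * B (star η) (frameProj ζ η (Pi.single q 1))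
        + A (star η) (frameProj ζ η (Pi.single q 1)) * B η (frameProj ζ η (Pi.single q 1)))
      + ∑ p, ∑ q, A (frameProj ζ η (Pi.single p 1)) (frameProj ζ η (Pi.single q 1))
          * B (frameProj ζ η (Pi.single p 1)) (frameProj ζ η (Pi.single q 1)) := by
  have outer : ∀ u v, ∑ p, A (Pi.single p 1) u * B (Pi.single p 1) v =
      1 / 2 * (A ζ u * B (star ζ) v + A (star ζ) u * B ζ v + A η u * B (star η) v
        + A (star η) u * B η v)
      + ∑ p, A (frameProj ζ η (Pi.single p 1)) u * B (frameProj ζ η (Pi.single p 1)) v :=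
    fun u v => contraction_frame hf (A.flip u) (B.flip v)
  have swap : ∑ p, ∑ q, A (Pi.single p 1) (frameProj ζ η (Pi.single q 1))
        * B (Pi.single p 1) (frameProj ζ η (Pi.single q 1)) =
      1 / 2 * ∑ q, (A ζ (frameProj ζ η (Pi.single q 1)) * B (star ζ) (frameProj ζ η (Pi.single q 1))
        + A (star ζ) (frameProj ζ η (Pi.single q 1)) * B ζ (frameProj ζ η (Pi.single q 1))
        + A η (frameProj ζ η (Pi.single q 1)) * B (star η) (frameProj ζ η (Pi.single q 1))
        + A (star η) (frameProj ζ η (Pi.single q 1)) * B η (frameProj ζ η (Pi.single q 1)))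
      + ∑ p, ∑ q, A (frameProj ζ η (Pi.single p 1)) (frameProj ζ η (Pi.single q 1))
          * B (frameProj ζ η (Pi.single p 1)) (frameProj ζ η (Pi.single q 1)) := by
    rw [Finset.sum_comm]
    simp only [outer, Finset.sum_add_distrib, ← Finset.mul_sum]
    congr 1
    exact Finset.sum_comm
  simp only [fun p => contraction_frame hf (A (Pi.single p 1)) (B (Pi.single p 1)),
    Finset.sum_add_distrib, ← Finset.mul_sum, outer, swap]
  ring

end NullFrame

section Positivity

variable {n : ℕ} {T : CForm n} {ζ η : CVec n}

lemma star_single_one (i : Fin n) : star (Pi.single i 1 : CVec n) = Pi.single i 1 := by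
  ext j
  simp [Pi.single_apply, apply_ite]

namespace IsComplexCurvature

lemma antisymm' (hT : IsComplexCurvature T) (x y z w : CVec n) :
    T x y z w = -T x y w z := by
  rw [hT.pair, hT.antisymm, hT.pair]

lemma self_left (hT : IsComplexCurvature T) (x z w : CVec n) : T x x z w = 0 :=
  self_eq_neg.mp (hT.antisymm x x z w)

lemma self_right (hT : IsComplexCurvature T) (x y z : CVec n) : T x y z z = 0 := by
  rw [hT.pair, hT.self_left]

end IsComplexCurvature

/-- At an isotropic plane of zero curvature, the contraction in Hamilton's quadratic term only sees
directions orthogonal to the plane and its conjugate. -/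
lemma sharp_contraction_eq (hT : IsComplexCurvature T) (hpos : NonnegOnIsotropic T)
    (hf : IsNullFrame ζ η) (h₀ : T ζ η (star ζ) (star η) = 0) :
    ∑ p, ∑ q, (T ζ (Pi.single p 1) (star ζ) (Pi.single q 1)
        * T η (Pi.single p 1) (star η) (Pi.single q 1)
      - T ζ (Pi.single p 1) (star η) (Pi.single q 1)
        * T η (Pi.single p 1) (star ζ) (Pi.single q 1)) =
    ∑ p, ∑ q, (T ζ (frameProj ζ η (Pi.single p 1)) (star ζ) (frameProj ζ η (Pi.single q 1))
        * T η (frameProj ζ η (Pi.single p 1)) (star η) (frameProj ζ η (Pi.single q 1))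
      - T ζ (frameProj ζ η (Pi.single p 1)) (star η) (frameProj ζ η (Pi.single q 1))
        * T η (frameProj ζ η (Pi.single p 1)) (star ζ) (frameProj ζ η (Pi.single q 1))) := by
  have h₀₁ : T η ζ (star ζ) (star η) = 0 := by rw [hT.antisymm, h₀, neg_zero]
  have h₀₂ : T ζ η (star η) (star ζ) = 0 := by rw [hT.antisymm', h₀, neg_zero]
  have h₀₃ : T η ζ (star η) (star ζ) = 0 := by rw [hT.antisymm, h₀₂, neg_zero]
  have first : ∀ p, IsOrthToFrame ζ η p → T p η (star ζ) (star η) = 0 := fun p hp => by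
    simpa using (hf.variation_orth hT hpos h₀ hp .zero).1
  have second : ∀ p, IsOrthToFrame ζ η p → T ζ p (star ζ) (star η) = 0 := fun p hp => by
    simpa using (hf.variation_orth hT hpos h₀ .zero hp).1
  have third : ∀ p, IsOrthToFrame ζ η p → T ζ η p (star η) = 0 := fun p hp => by
    rw [hT.pair, ← star_eq_zero, hT.conj, star_star, first _ hp.star]
  have fourth : ∀ p, IsOrthToFrame ζ η p → T ζ η (star ζ) p = 0 := fun p hp => by
    rw [hT.pair, ← star_eq_zero, hT.conj, star_star, second _ hp.star]
  have z₁ : ∀ p, T ζ (frameProj ζ η p) (star ζ) (star η) = 0 := fun p =>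
    second _ (isOrthToFrame_frameProj hf p)
  have z₂ : ∀ p, T ζ (frameProj ζ η p) (star η) (star ζ) = 0 := fun p => by
    rw [hT.antisymm', z₁, neg_zero]
  have z₃ : ∀ p, T η (frameProj ζ η p) (star ζ) (star η) = 0 := fun p => by
    rw [hT.antisymm, first _ (isOrthToFrame_frameProj hf p), neg_zero]
  have z₄ : ∀ p, T η (frameProj ζ η p) (star η) (star ζ) = 0 := fun p => by
    rw [hT.antisymm', z₃, neg_zero]
  have z₅ : ∀ p, T ζ η (star ζ) (frameProj ζ η p) = 0 := fun p =>
    fourth _ (isOrthToFrame_frameProj hf p)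
  have z₆ : ∀ p, T η ζ (star ζ) (frameProj ζ η p) = 0 := fun p => by
    rw [hT.antisymm, z₅, neg_zero]
  have z₇ : ∀ p, T ζ η (star η) (frameProj ζ η p) = 0 := fun p => by
    rw [hT.antisymm', third _ (isOrthToFrame_frameProj hf p), neg_zero]
  have z₈ : ∀ p, T η ζ (star η) (frameProj ζ η p) = 0 := fun p => by
    rw [hT.antisymm, z₇, neg_zero]
  have rot : T (star η) η (star ζ) (star η) = T ζ (star ζ) (star ζ) (star η) :=
    hf.variation_rotation hT hpos h₀
  have rot' : T η (star η) ζ η = T (star ζ) ζ ζ η := by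
    simpa only [hT.conj, star_star] using congrArg star rot
  have y₁ : T ζ (star ζ) (star η) (star ζ) = -T ζ (star ζ) (star ζ) (star η) := hT.antisymm' _ _ _ _
  have y₂ : T η (star η) (star ζ) (star η) = -T ζ (star ζ) (star ζ) (star η) := by
    rw [hT.antisymm, rot]
  have y₃ : T η (star η) (star η) (star ζ) = T ζ (star ζ) (star ζ) (star η) := by
    rw [hT.antisymm', y₂, neg_neg]
  have y₄ : T ζ η (star ζ) ζ = T (star ζ) ζ ζ η := hT.pair _ _ _ _
  have y₅ : T η ζ (star ζ) ζ = -T (star ζ) ζ ζ η := by rw [hT.antisymm, y₄]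
  have y₆ : T ζ η (star η) η = -T (star ζ) ζ ζ η := by
    rw [hT.antisymm', hT.pair, rot']
  have y₇ : T η ζ (star η) η = T (star ζ) ζ ζ η := by rw [hT.antisymm, y₆, neg_neg]
  have hAB := double_contraction_frame hf ((T ζ).flip (star ζ)) ((T η).flip (star η))
  have hCD := double_contraction_frame hf ((T ζ).flip (star η)) ((T η).flip (star ζ))
  simp only [LinearMap.flip_apply, hT.self_left, hT.self_right, h₀, h₀₁, h₀₂, h₀₃, z₁, z₂, z₃, z₄,
    z₅, z₆, z₇, z₈, zero_mul, mul_zero, add_zero, zero_add, Finset.sum_const_zero] at hAB hCD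
  simp only [Finset.sum_sub_distrib]
  rw [hAB, hCD, y₁, y₂, y₃, y₄, y₅, y₆, y₇]
  ring

open scoped ComplexOrder in
lemma sum_hadamard_blocks_nonneg {m : Type*} [Fintype m] [DecidableEq m] {A B C : Matrix m m ℂ}
    (h : (Matrix.fromBlocks B (-Cᴴ) (-C) A).PosSemidef) :
    0 ≤ (∑ a, ∑ b, (A a b * B a b - C a b * Cᴴ a b)).re := by
  let J : Matrix (m ⊕ m) (m ⊕ m) ℂ := Matrix.fromBlocks 0 1 (-1) 0
  have hJ : Jᴴ * Matrix.fromBlocks B (-Cᴴ) (-C) A * J = Matrix.fromBlocks A C Cᴴ B := by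
    simp [J, Matrix.fromBlocks_conjTranspose, Matrix.fromBlocks_multiply]
  have h' := h.conjTranspose_mul_mul_same J
  rw [hJ] at h'
  have key := (Matrix.posSemidef_iff_dotProduct_mulVec.mp (h.hadamard h')).2 1
  simp only [dotProduct, mulVec, Fintype.sum_sum_type, Matrix.hadamard_apply, star_one, Pi.one_apply,
    one_mul, mul_one, Matrix.fromBlocks_apply₁₁, Matrix.fromBlocks_apply₁₂,
    Matrix.fromBlocks_apply₂₁, Matrix.fromBlocks_apply₂₂, Matrix.neg_apply] at key
  have key' := (Complex.le_def.mp key).1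
  have : (∑ a, (∑ b, B a b * A a b + ∑ b, -Cᴴ a b * C a b)
      + ∑ a, (∑ b, -C a b * Cᴴ a b + ∑ b, A a b * B a b)) =
      2 * ∑ a, ∑ b, (A a b * B a b - C a b * Cᴴ a b) := by
    simp only [Finset.mul_sum, ← Finset.sum_add_distrib]
    refine Finset.sum_congr rfl fun a _ => Finset.sum_congr rfl fun b _ => ?_
    ring
  rw [this] at key'
  simpa using key'

lemma linear_eq_sum_frameProj (f : CVec n →ₗ[ℂ] ℂ) (x : CVec n) :
    f (frameProj ζ η x) = ∑ p, f (frameProj ζ η (Pi.single p 1)) * x p :=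
  linear_eq_sum (f ∘ₗ frameProj ζ η) x

lemma star_frameProj_single (p : Fin n) :
    star (frameProj ζ η (Pi.single p 1)) = frameProj ζ η (Pi.single p 1) := by
  rw [star_frameProj, star_single_one]

lemma star_apply_frameProj (hT : IsComplexCurvature T) (x y : CVec n) (p q : Fin n) :
    star (T x (frameProj ζ η (Pi.single p 1)) (star y) (frameProj ζ η (Pi.single q 1))) =
      T y (frameProj ζ η (Pi.single q 1)) (star x) (frameProj ζ η (Pi.single p 1)) := by
  rw [hT.conj, star_frameProj_single, star_frameProj_single, star_star, hT.pair]

open scoped ComplexOrder in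
/-- The second variation inequality as positive semidefiniteness of a block matrix. -/
lemma posSemidef_second_variation (hT : IsComplexCurvature T) (hpos : NonnegOnIsotropic T)
    (hf : IsNullFrame ζ η) (h₀ : T ζ η (star ζ) (star η) = 0) :
    let π : Fin n → CVec n := fun p => frameProj ζ η (Pi.single p 1)
    let C : Matrix (Fin n) (Fin n) ℂ := .of fun p q => T ζ (π p) (star η) (π q)
    (Matrix.fromBlocks (.of fun p q => T η (π p) (star η) (π q)) (-Cᴴ) (-C)
      (.of fun p q => T ζ (π p) (star ζ) (π q))).PosSemidef := by
  intro π C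
  have herm : ∀ x y, ∀ p q, star (T x (π p) (star y) (π q)) = T y (π q) (star x) (π p) :=
    star_apply_frameProj hT
  have hCH : ∀ p q, Cᴴ p q = T η (π p) (star ζ) (π q) := fun p q => herm _ _ _ _
  have hH : (Matrix.fromBlocks (.of fun p q => T η (π p) (star η) (π q)) (-Cᴴ) (-C)
      (.of fun p q => T ζ (π p) (star ζ) (π q))).IsHermitian := by
    refine Matrix.IsHermitian.fromBlocks ?_ (by simp) ?_
    · ext p q; exact herm _ _ _ _
    · ext p q; exact herm _ _ _ _
  refine Matrix.posSemidef_iff_dotProduct_mulVec.mpr ⟨hH, fun x => ?_⟩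
  let p : CVec n := fun a => star (x (Sum.inl a))
  let q : CVec n := fun a => star (x (Sum.inr a))
  have expand : ∀ u v w z : CVec n,
      ∑ a, ∑ b, w a * T u (π a) v (π b) * star (z b) =
        T u (frameProj ζ η w) v (star (frameProj ζ η z)) := by
    intro u v w z
    rw [star_frameProj, linear_eq_sum_frameProj (T u (frameProj ζ η w) v), Finset.sum_comm]
    refine Finset.sum_congr rfl fun b _ => ?_
    change _ = (((T u).flip v).flip (π b)) (frameProj ζ η w) * _
    rw [linear_eq_sum_frameProj, Finset.sum_mul]
    refine Finset.sum_congr rfl fun a _ => ?_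
    simp only [LinearMap.flip_apply, Pi.star_apply, π]
    ring
  have value : star x ⬝ᵥ (Matrix.fromBlocks (.of fun p q => T η (π p) (star η) (π q)) (-Cᴴ) (-C)
      (.of fun p q => T ζ (π p) (star ζ) (π q)) *ᵥ x) =
      T η (frameProj ζ η p) (star η) (star (frameProj ζ η p))
      - T η (frameProj ζ η p) (star ζ) (star (frameProj ζ η q))
      - T ζ (frameProj ζ η q) (star η) (star (frameProj ζ η p))
      + T ζ (frameProj ζ η q) (star ζ) (star (frameProj ζ η q)) := by
    simp only [← expand, dotProduct, mulVec, Fintype.sum_sum_type, Matrix.fromBlocks_apply₁₁,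
      Matrix.fromBlocks_apply₁₂, Matrix.fromBlocks_apply₂₁, Matrix.fromBlocks_apply₂₂,
      Matrix.neg_apply, hCH, p, q, star_star, Pi.star_apply, Matrix.of_apply, C, mul_add,
      Finset.mul_sum, Finset.sum_add_distrib, neg_mul, mul_neg, Finset.sum_neg_distrib, mul_assoc]
    ring
  have key := (hf.variation_orth hT hpos h₀ (isOrthToFrame_frameProj hf p)
    (isOrthToFrame_frameProj hf q)).2
  rw [hT.antisymm (frameProj ζ η p), hT.antisymm' η, hT.antisymm (frameProj ζ η p),
    hT.antisymm' ζ (frameProj ζ η q) (star (frameProj ζ η p))] at key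
  refine Complex.le_def.mpr ⟨?_, ?_⟩
  · rw [value, Complex.zero_re]
    convert key using 2
    ring
  · exact (IsHermitian.im_star_dotProduct_mulVec_self hH x).symm

/-- The contraction in Hamilton's quadratic term is nonnegative at an isotropic plane of zero
curvature. -/
lemma sharp_contraction_nonneg (hT : IsComplexCurvature T) (hpos : NonnegOnIsotropic T)
    (hf : IsNullFrame ζ η) (h₀ : T ζ η (star ζ) (star η) = 0) :
    0 ≤ (∑ p, ∑ q, (T ζ (Pi.single p 1) (star ζ) (Pi.single q 1)
        * T η (Pi.single p 1) (star η) (Pi.single q 1)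
      - T ζ (Pi.single p 1) (star η) (Pi.single q 1)
        * T η (Pi.single p 1) (star ζ) (Pi.single q 1))).re := by
  rw [sharp_contraction_eq hT hpos hf h₀]
  have h := sum_hadamard_blocks_nonneg (posSemidef_second_variation hT hpos hf h₀)
  simpa only [Matrix.conjTranspose_apply, Matrix.of_apply, star_apply_frameProj hT] using h

end Positivity

section Complexification

variable {n : ℕ}

/-- The complex multilinear extension of a real array of components. -/
def complexify (r : Fin n → Fin n → Fin n → Fin n → ℝ) : CForm n :=
  (Pi.basisFun ℂ (Fin n)).constr ℂ fun i => (Pi.basisFun ℂ (Fin n)).constr ℂ fun j =>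
    (Pi.basisFun ℂ (Fin n)).constr ℂ fun k => (Pi.basisFun ℂ (Fin n)).constr ℂ fun l =>
      (r i j k l : ℂ)

lemma complexify_apply (r : Fin n → Fin n → Fin n → Fin n → ℝ) (x y z w : CVec n) :
    complexify r x y z w =
      ∑ i, ∑ j, ∑ k, ∑ l, x i * (y j * (z k * (w l * (r i j k l : ℂ)))) := by
  simp [complexify, Module.Basis.constr_apply_fintype, Finset.mul_sum]

lemma complexify_single (r : Fin n → Fin n → Fin n → Fin n → ℝ) (i j k l : Fin n) :
    complexify r (Pi.single i 1) (Pi.single j 1) (Pi.single k 1) (Pi.single l 1) = r i j k l := by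
  simp [complexify_apply, Pi.single_apply]

/-- The components of `R` in the orthonormal basis `b`. -/
def components (R : CurvMap n) (b : OrthonormalBasis (Fin n) ℝ (Euc n)) (i j k l : Fin n) : ℝ :=
  R (b i) (b j) (b k) (b l)

lemma complexify_components_ofReal (R : CurvMap n) (b : OrthonormalBasis (Fin n) ℝ (Euc n))
    (x y z w : Fin n → ℝ) :
    complexify (components R b) (fun i => (x i : ℂ)) (fun i => (y i : ℂ)) (fun i => (z i : ℂ))
      (fun i => (w i : ℂ)) =
    (R (∑ i, x i • b i) (∑ i, y i • b i) (∑ i, z i • b i) (∑ i, w i • b i) : ℝ) := by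
  have h₁ : ∀ y z w, R (∑ i, x i • b i) y z w = ∑ i, x i * R (b i) y z w := fun y z w => by
    simp [LinearMap.sum_apply]
  have h₂ : ∀ x z w, R x (∑ i, y i • b i) z w = ∑ i, y i * R x (b i) z w := fun x z w => by
    simp [LinearMap.sum_apply]
  have h₃ : ∀ x y w, R x y (∑ i, z i • b i) w = ∑ i, z i * R x y (b i) w := fun x y w => by
    simp [LinearMap.sum_apply]
  have h₄ : ∀ x y z, R x y z (∑ i, w i • b i) = ∑ i, w i * R x y z (b i) := fun x y z => by
    simp
  simp only [complexify_apply, components, h₁, h₂, h₃, h₄, Finset.mul_sum, Complex.ofReal_sum,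
    Complex.ofReal_mul]

lemma isComplexCurvature_complexify {R : CurvMap n} (hR : IsCurvatureTensor R)
    (b : OrthonormalBasis (Fin n) ℝ (Euc n)) : IsComplexCurvature (complexify (components R b)) := by
  obtain ⟨h₁, h₂, h₃⟩ := hR
  have pair : ∀ x y z w, complexify (components R b) x y z w
      = complexify (components R b) z w x y := by
    intro x y z w
    simp only [complexify_apply, ← Fintype.sum_prod_type']
    let σ : (Fin n × Fin n × Fin n × Fin n) ≃ (Fin n × Fin n × Fin n × Fin n) :=
      { toFun := fun u => (u.2.2.1, u.2.2.2, u.1, u.2.1)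
        invFun := fun u => (u.2.2.1, u.2.2.2, u.1, u.2.1)
        left_inv := fun _ => rfl
        right_inv := fun _ => rfl }
    refine Fintype.sum_equiv σ _ _ fun u => ?_
    simp only [σ, Equiv.coe_fn_mk, components, h₂ (b u.1)]
    ring
  refine ⟨fun x y z w => ?_, pair, fun x y z w => ?_, fun x y z w => ?_⟩
  · rw [complexify_apply, complexify_apply, Finset.sum_comm]
    simp only [← Finset.sum_neg_distrib]
    refine Finset.sum_congr rfl fun i _ => Finset.sum_congr rfl fun j _ =>
      Finset.sum_congr rfl fun k _ => Finset.sum_congr rfl fun l _ => ?_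
    simp only [components, h₁ (b j) (b i), Complex.ofReal_neg]
    ring
  · have e₁ : complexify (components R b) y z x w = ∑ i, ∑ j, ∑ k, ∑ l,
        x i * (y j * (z k * (w l * (components R b j k i l : ℂ)))) := by
      rw [complexify_apply]
      simp only [← Fintype.sum_prod_type']
      let σ : (Fin n × Fin n × Fin n × Fin n) ≃ (Fin n × Fin n × Fin n × Fin n) :=
        { toFun := fun u => (u.2.2.1, u.1, u.2.1, u.2.2.2)
          invFun := fun u => (u.2.1, u.2.2.1, u.1, u.2.2.2)
          left_inv := fun _ => rfl
          right_inv := fun _ => rfl }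
      refine Fintype.sum_equiv σ _ _ fun u => ?_
      simp only [σ, Equiv.coe_fn_mk]
      ring
    have e₂ : complexify (components R b) z x y w = ∑ i, ∑ j, ∑ k, ∑ l,
        x i * (y j * (z k * (w l * (components R b k i j l : ℂ)))) := by
      rw [complexify_apply]
      simp only [← Fintype.sum_prod_type']
      let σ : (Fin n × Fin n × Fin n × Fin n) ≃ (Fin n × Fin n × Fin n × Fin n) :=
        { toFun := fun u => (u.2.1, u.2.2.1, u.1, u.2.2.2)
          invFun := fun u => (u.2.2.1, u.1, u.2.1, u.2.2.2)
          left_inv := fun _ => rfl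
          right_inv := fun _ => rfl }
      refine Fintype.sum_equiv σ _ _ fun u => ?_
      simp only [σ, Equiv.coe_fn_mk]
      ring
    rw [complexify_apply, e₁, e₂]
    simp only [← Finset.sum_add_distrib]
    refine Finset.sum_eq_zero fun i _ => Finset.sum_eq_zero fun j _ => Finset.sum_eq_zero fun k _ =>
      Finset.sum_eq_zero fun l _ => ?_
    have h : (components R b i j k l : ℂ) + components R b j k i l + components R b k i j l = 0 := by
      exact_mod_cast h₃ (b i) (b j) (b k) (b l)
    linear_combination x i * y j * z k * w l * h
  · simp [complexify_apply]

/-- The complex sectional curvature of `(a + ib) ∧ (c + id)` is the isotropic curvature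
expression. -/
lemma isotropic_expansion {T : CForm n} (hT : IsComplexCurvature T) (a b c d : CVec n) :
    T (a + Complex.I • b) (c + Complex.I • d) (a - Complex.I • b) (c - Complex.I • d) =
      T a c a c + T a d a d + T b c b c + T b d b d - 2 * T a b c d := by
  simp only [map_add, map_sub, map_smul, LinearMap.add_apply, LinearMap.sub_apply,
    LinearMap.smul_apply, smul_eq_mul]
  have hI := Complex.I_sq
  have e₁ := hT.pair a c a d
  have e₂ := hT.pair a c b c
  have e₃ := hT.pair b d a d
  have e₄ := hT.pair b d b c
  have e₅ := hT.pair a c b d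
  have e₆ := hT.pair a d b c
  have e₇ := hT.antisymm c a b d
  have e₈ := hT.bianchi a b c d
  have e₉ := hT.pair a d a c
  grind

/-- The isotropic curvature of orthogonal vectors that are normalised only pairwise. -/
lemma nonneg_of_orthogonal {R : CurvMap n} (hnic : NonnegIsotropic (fun x y z w => R x y z w))
    {a b c d : Euc n} (hab : inner ℝ b b = inner ℝ a a) (hcd : inner ℝ d d = inner ℝ c c)
    (oab : inner ℝ a b = 0) (ocd : inner ℝ c d = 0) (oac : inner ℝ a c = 0)
    (obd : inner ℝ b d = 0) (oad : inner ℝ a d = 0) (obc : inner ℝ b c = 0) :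
    0 ≤ R a c a c + R a d a d + R b c b c + R b d b d - 2 * R a b c d := by
  have hb : ‖b‖ = ‖a‖ := by
    simp only [real_inner_self_eq_norm_sq] at hab
    exact (sq_eq_sq₀ (norm_nonneg _) (norm_nonneg _)).mp hab
  have hd : ‖d‖ = ‖c‖ := by
    simp only [real_inner_self_eq_norm_sq] at hcd
    exact (sq_eq_sq₀ (norm_nonneg _) (norm_nonneg _)).mp hcd
  rcases eq_or_ne a 0 with rfl | ha
  · have : b = 0 := by simpa using hb
    simp [this]
  rcases eq_or_ne c 0 with rfl | hc
  · have : d = 0 := by simpa using hd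
    simp [this]
  have ha' : ‖a‖ ≠ 0 := norm_ne_zero_iff.mpr ha
  have hc' : ‖c‖ ≠ 0 := norm_ne_zero_iff.mpr hc
  have oba := (real_inner_comm a b).trans oab
  have odc := (real_inner_comm c d).trans ocd
  have oca := (real_inner_comm a c).trans oac
  have odb := (real_inner_comm b d).trans obd
  have oda := (real_inner_comm a d).trans oad
  have ocb := (real_inner_comm b c).trans obc
  have hon : Orthonormal ℝ ![‖a‖⁻¹ • a, ‖a‖⁻¹ • b, ‖c‖⁻¹ • c, ‖c‖⁻¹ • d] := by
    rw [orthonormal_iff_ite]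
    intro i j
    fin_cases i <;> fin_cases j <;>
      simp [real_inner_smul_left, real_inner_smul_right, norm_smul, *]
  have key := hnic _ _ _ _ hon
  simp only [map_smul, LinearMap.smul_apply, smul_eq_mul] at key
  have hpos : 0 < (‖a‖⁻¹) ^ 2 * (‖c‖⁻¹) ^ 2 := by positivity
  refine nonneg_of_mul_nonneg_right (key.trans_eq ?_) hpos
  ring

lemma nonneg_of_hermitian_orthogonal {R : CurvMap n} (hR : IsCurvatureTensor R)
    (b : OrthonormalBasis (Fin n) ℝ (Euc n)) (hnic : NonnegIsotropic (fun x y z w => R x y z w))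
    {x y : CVec n} (hxx : x ⬝ᵥ x = 0) (hyy : y ⬝ᵥ y = 0) (hxy : x ⬝ᵥ y = 0)
    (hxy' : x ⬝ᵥ star y = 0) :
    0 ≤ (complexify (components R b) x y (star x) (star y)).re := by
  let re : CVec n → Euc n := fun v => ∑ i, (v i).re • b i
  let im : CVec n → Euc n := fun v => ∑ i, (v i).im • b i
  have inner_sum : ∀ f g : Fin n → ℝ,
      inner ℝ (∑ i, f i • b i) (∑ i, g i • b i) = ∑ i, f i * g i := fun f g => by
    simp [b.orthonormal.inner_sum]
  have dot : ∀ u v : CVec n, u ⬝ᵥ v = (⟨inner ℝ (re u) (re v) - inner ℝ (im u) (im v),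
      inner ℝ (re u) (im v) + inner ℝ (im u) (re v)⟩ : ℂ) := by
    intro u v
    simp only [re, im, inner_sum]
    apply Complex.ext <;>
      simp [dotProduct, Complex.re_sum, Complex.im_sum, Finset.sum_sub_distrib,
        Finset.sum_add_distrib]
  have re_star : re (star y) = re y := by simp [re]
  have im_star : im (star y) = -im y := by simp [im]
  simp only [dot, re_star, im_star, inner_neg_right, Complex.ext_iff, Complex.zero_re,
    Complex.zero_im] at hxx hyy hxy hxy'
  have split : ∀ v : CVec n,
      v = (fun i => ((v i).re : ℂ)) + Complex.I • (fun i => ((v i).im : ℂ)) := by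
    intro v; ext i
    simp [mul_comm Complex.I, Complex.re_add_im]
  have split_star : ∀ v : CVec n,
      star v = (fun i => ((v i).re : ℂ)) - Complex.I • (fun i => ((v i).im : ℂ)) := by
    intro v; ext i
    apply Complex.ext <;> simp
  have value : (complexify (components R b) x y (star x) (star y)).re =
      R (re x) (re y) (re x) (re y) + R (re x) (im y) (re x) (im y)
      + R (im x) (re y) (im x) (re y) + R (im x) (im y) (im x) (im y)
      - 2 * R (re x) (im x) (re y) (im y) := by
    have h : complexify (components R b) x y (star x) (star y) = _ :=
      calc
        _ = complexify (components R b)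
              ((fun i => ((x i).re : ℂ)) + Complex.I • (fun i => ((x i).im : ℂ)))
              ((fun i => ((y i).re : ℂ)) + Complex.I • (fun i => ((y i).im : ℂ)))
              ((fun i => ((x i).re : ℂ)) - Complex.I • (fun i => ((x i).im : ℂ)))
              ((fun i => ((y i).re : ℂ)) - Complex.I • (fun i => ((y i).im : ℂ))) := by
          rw [← split x, ← split y, ← split_star x, ← split_star y]
        _ = _ := isotropic_expansion (isComplexCurvature_complexify hR b) _ _ _ _
    rw [h]
    simp only [complexify_components_ofReal]
    norm_cast
  rw [value]
  have sx : inner ℝ (im x) (im x) = inner ℝ (re x) (re x) := by linarith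
  have sy : inner ℝ (im y) (im y) = inner ℝ (re y) (re y) := by linarith
  have o₁ : inner ℝ (re x) (im x) = 0 := by
    have := real_inner_comm (re x) (im x); linarith
  have o₂ : inner ℝ (re y) (im y) = 0 := by
    have := real_inner_comm (re y) (im y); linarith
  have o₃ : inner ℝ (re x) (re y) = 0 := by linarith
  have o₄ : inner ℝ (im x) (im y) = 0 := by linarith
  have o₅ : inner ℝ (re x) (im y) = 0 := by linarith
  have o₆ : inner ℝ (im x) (re y) = 0 := by linarith
  exact nonneg_of_orthogonal hnic sx sy o₁ o₂ o₃ o₄ o₅ o₆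

open scoped ComplexOrder in
/-- Gram–Schmidt reduces arbitrary isotropic pairs to Hermitian-orthogonal ones. -/
lemma nonnegOnIsotropic_complexify {R : CurvMap n} (hR : IsCurvatureTensor R)
    (b : OrthonormalBasis (Fin n) ℝ (Euc n))
    (hnic : NonnegIsotropic (fun x y z w => R x y z w)) :
    NonnegOnIsotropic (complexify (components R b)) := by
  intro x y hxx hyy hxy
  have hT := isComplexCurvature_complexify hR b
  rcases eq_or_ne x 0 with rfl | hx
  · simp
  have hN : x ⬝ᵥ star x ≠ 0 := fun h => hx (dotProduct_self_star_eq_zero.mp h)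
  let c : ℂ := y ⬝ᵥ star x / (x ⬝ᵥ star x)
  have key := nonneg_of_hermitian_orthogonal hR b hnic (x := x) (y := y - c • x) hxx
    (by simp [hxx, hyy, hxy, dotProduct_comm y x]) (by simp [hxx, hxy])
    (by
      rw [← star_dotProduct_eq_zero_iff, dotProduct_comm, sub_dotProduct, smul_dotProduct,
        smul_eq_mul, div_mul_cancel₀ _ hN, sub_self])
  simpa only [map_sub, map_smul, LinearMap.sub_apply, LinearMap.smul_apply, star_sub, star_smul,
    hT.self_left, hT.self_right, smul_zero, sub_zero] using key

end Complexification

section HamiltonQuadratic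

variable {n : ℕ} {R : CurvMap n}

/-- The contraction `∑ R_{ipjq} R_{kplq}` of the curvature tensor with itself. -/
def crossContraction (R : CurvMap n) (b : OrthonormalBasis (Fin n) ℝ (Euc n))
    (i j k l : Fin n) : ℝ :=
  ∑ p, ∑ q, R (b i) (b p) (b j) (b q) * R (b k) (b p) (b l) (b q)

lemma crossContraction_comm (R : CurvMap n) (b : OrthonormalBasis (Fin n) ℝ (Euc n))
    (i j k l : Fin n) : crossContraction R b i j k l = crossContraction R b k l i j := by
  simp only [crossContraction, mul_comm]

lemma crossContraction_swap (hR : IsCurvatureTensor R) (b : OrthonormalBasis (Fin n) ℝ (Euc n))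
    (i j k l : Fin n) : crossContraction R b j i l k = crossContraction R b i j k l := by
  rw [crossContraction, Finset.sum_comm]
  refine Finset.sum_congr rfl fun p _ => Finset.sum_congr rfl fun q _ => ?_
  rw [hR.2.1 (b j), hR.2.1 (b l)]

lemma Qc_eq_crossContraction (hR : IsCurvatureTensor R)
    (b : OrthonormalBasis (Fin n) ℝ (Euc n)) (i j k l : Fin n) :
    Qc R b i j k l = 2 * (crossContraction R b i j k l - crossContraction R b i j l k
      + crossContraction R b i k j l - crossContraction R b i l j k) := by
  have bianchi : ∀ x y z w, R x y z w = R x z y w - R x w y z := fun x y z w => by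
    linarith [hR.2.2 x y z w, hR.2.1 y z x w, hR.1 z x y w]
  have h₁ : ∑ p, ∑ q, R (b i) (b q) (b j) (b p) * R (b k) (b q) (b l) (b p) =
      crossContraction R b i j k l := Finset.sum_comm
  have h₂ : ∑ p, ∑ q, R (b i) (b p) (b j) (b q) * R (b k) (b q) (b l) (b p) =
      crossContraction R b i j l k := by
    simp only [hR.2.1 (b k), crossContraction]
  have h₃ : ∑ p, ∑ q, R (b i) (b q) (b j) (b p) * R (b k) (b p) (b l) (b q) =
      crossContraction R b i j l k := by
    rw [Finset.sum_comm, h₂]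
  have h₄ : ∑ p, ∑ q, R (b i) (b p) (b j) (b q) * R (b k) (b p) (b l) (b q) =
      crossContraction R b i j k l := rfl
  have first : ∑ p, ∑ q, R (b i) (b j) (b p) (b q) * R (b k) (b l) (b p) (b q) =
      2 * crossContraction R b i j k l - 2 * crossContraction R b i j l k := by
    simp only [bianchi (b i) (b j), bianchi (b k) (b l), sub_mul, mul_sub, Finset.sum_sub_distrib,
      h₁, h₂, h₃, h₄]
    ring
  simp only [Qc, Finset.sum_add_distrib, Finset.sum_sub_distrib, mul_assoc, ← Finset.mul_sum, first]
  simp only [crossContraction]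
  ring

lemma Qc_pair (hR : IsCurvatureTensor R) (b : OrthonormalBasis (Fin n) ℝ (Euc n))
    (i j k l : Fin n) : Qc R b i j k l = Qc R b k l i j := by
  rw [Qc_eq_crossContraction hR, Qc_eq_crossContraction hR, crossContraction_comm R b k l i j,
    crossContraction_comm R b k l j i, crossContraction_swap hR b i j l k,
    crossContraction_swap hR b i k j l, crossContraction_comm R b k j l i,
    crossContraction_swap hR b i l j k]

lemma Qc_bianchi (hR : IsCurvatureTensor R) (b : OrthonormalBasis (Fin n) ℝ (Euc n))
    (i j k l : Fin n) : Qc R b i k j l - Qc R b i l j k = Qc R b i j k l := by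
  simp only [Qc_eq_crossContraction hR]
  ring

lemma isNullFrame_single {i j k l : Fin n} (hij : i ≠ j) (hik : i ≠ k) (hil : i ≠ l)
    (hjk : j ≠ k) (hjl : j ≠ l) (hkl : k ≠ l) :
    IsNullFrame (Pi.single i 1 + Complex.I • Pi.single j 1 : CVec n)
      (Pi.single k 1 + Complex.I • Pi.single l 1) := by
  constructor <;>
    simp [hij, hkl, hij.symm, hik.symm, hil.symm, hjk.symm,
      hjl.symm, hkl.symm, one_add_one_eq_two]

lemma star_single_add (i j : Fin n) :
    star (Pi.single i 1 + Complex.I • Pi.single j 1 : CVec n) =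
      Pi.single i 1 - Complex.I • Pi.single j 1 := by
  have hI : star Complex.I = -Complex.I := Complex.conj_I
  rw [star_add, star_smul, star_single_one, star_single_one, hI, neg_smul, ← sub_eq_add_neg]

/-- The isotropic part of Hamilton's quadratic term as a square plus the mixed contraction. -/
lemma isotropic_Qc_eq (hR : IsCurvatureTensor R) (b : OrthonormalBasis (Fin n) ℝ (Euc n))
    (i j k l : Fin n) :
    let T := complexify (components R b)
    let ζ : CVec n := Pi.single i 1 + Complex.I • Pi.single j 1
    let η : CVec n := Pi.single k 1 + Complex.I • Pi.single l 1
    Qc R b i k i k + Qc R b i l i l + Qc R b j k j k + Qc R b j l j l - 2 * Qc R b i j k l =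
      ∑ p, ∑ q, Complex.normSq (T ζ η (Pi.single p 1) (Pi.single q 1))
      + 2 * (∑ p, ∑ q, (T ζ (Pi.single p 1) (star ζ) (Pi.single q 1)
          * T η (Pi.single p 1) (star η) (Pi.single q 1)
        - T ζ (Pi.single p 1) (star η) (Pi.single q 1)
          * T η (Pi.single p 1) (star ζ) (Pi.single q 1))).re := by
  intro T ζ η
  have h : Qc R b i k i k + Qc R b i l i l + Qc R b j k j k + Qc R b j l j l
      - 2 * Qc R b i j k l =
      Qc R b i k i k + Qc R b i l i l + Qc R b j k j k + Qc R b j l j l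
      - Qc R b i k j l - Qc R b j l i k + Qc R b i l j k + Qc R b j k i l := by
    rw [Qc_pair hR b j l i k, Qc_pair hR b j k i l, ← Qc_bianchi hR b i j k l]
    ring
  rw [h]
  simp only [Qc, Complex.re_sum, Finset.mul_sum, ← Finset.sum_add_distrib, ← Finset.sum_sub_distrib]
  refine Finset.sum_congr rfl fun p _ => Finset.sum_congr rfl fun q _ => ?_
  simp only [T, ζ, η, star_single_add, map_add, map_sub, map_smul, LinearMap.add_apply,
    LinearMap.sub_apply, LinearMap.smul_apply, complexify_single, smul_eq_mul, components,
    Complex.normSq_apply, Complex.add_re, Complex.add_im, Complex.sub_re, Complex.sub_im,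
    Complex.mul_re, Complex.mul_im, Complex.I_re, Complex.I_im, Complex.ofReal_re,
    Complex.ofReal_im]
  ring

end HamiltonQuadratic

/-- Corollary `pic.is.preserved.1` (second part): at a frame where the isotropic curvature
attains its minimum value zero, the corresponding combination of components of `Q(R)` is
nonnegative. -/
theorem stmt_1 {n : ℕ} (hn : 4 ≤ n) (R : CurvMap n) (hR : IsCurvatureTensor R)
    (b : OrthonormalBasis (Fin n) ℝ (Euc n))
    (hnic : NonnegIsotropic (fun x y z w => R x y z w)) :
    let i₁ : Fin n := ⟨0, by omega⟩
    let i₂ : Fin n := ⟨1, by omega⟩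
    let i₃ : Fin n := ⟨2, by omega⟩
    let i₄ : Fin n := ⟨3, by omega⟩
    R (b i₁) (b i₃) (b i₁) (b i₃) + R (b i₁) (b i₄) (b i₁) (b i₄)
      + R (b i₂) (b i₃) (b i₂) (b i₃) + R (b i₂) (b i₄) (b i₂) (b i₄)
      - 2 * R (b i₁) (b i₂) (b i₃) (b i₄) = 0 →
    0 ≤ Qc R b i₁ i₃ i₁ i₃ + Qc R b i₁ i₄ i₁ i₄ + Qc R b i₂ i₃ i₂ i₃ + Qc R b i₂ i₄ i₂ i₄
        - 2 * Qc R b i₁ i₂ i₃ i₄ := by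
  intro i₁ i₂ i₃ i₄ hzero
  have h₁₂ : i₁ ≠ i₂ := by simp [i₁, i₂]
  have h₁₃ : i₁ ≠ i₃ := by simp [i₁, i₃]
  have h₁₄ : i₁ ≠ i₄ := by simp [i₁, i₄]
  have h₂₃ : i₂ ≠ i₃ := by simp [i₂, i₃]
  have h₂₄ : i₂ ≠ i₄ := by simp [i₂, i₄]
  have h₃₄ : i₃ ≠ i₄ := by simp [i₃, i₄]
  have hT := isComplexCurvature_complexify hR b
  have hpos := nonnegOnIsotropic_complexify hR b hnic
  have hf := isNullFrame_single h₁₂ h₁₃ h₁₄ h₂₃ h₂₄ h₃₄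
  rw [isotropic_Qc_eq hR b i₁ i₂ i₃ i₄]
  have h₀ : complexify (components R b) (Pi.single i₁ 1 + Complex.I • Pi.single i₂ 1)
      (Pi.single i₃ 1 + Complex.I • Pi.single i₄ 1)
      (star (Pi.single i₁ 1 + Complex.I • Pi.single i₂ 1))
      (star (Pi.single i₃ 1 + Complex.I • Pi.single i₄ 1)) = 0 := by
    rw [star_single_add, star_single_add, isotropic_expansion hT]
    simp only [complexify_single, components]
    exact_mod_cast hzero
  have hsq := Finset.sum_nonneg fun p (_ : p ∈ Finset.univ) => Finset.sum_nonneg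
    fun q (_ : q ∈ Finset.univ) => Complex.normSq_nonneg
      (complexify (components R b) (Pi.single i₁ 1 + Complex.I • Pi.single i₂ 1)
        (Pi.single i₃ 1 + Complex.I • Pi.single i₄ 1) (Pi.single p 1) (Pi.single q 1))
  exact add_nonneg hsq (mul_nonneg zero_le_two (sharp_contraction_nonneg hT hpos hf h₀))
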